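/- B = A[X;*]^fl is flexible (i.e. (pq)p = p(qp) for all p, q ∈ B) if and only if A is flexible ((ab)a = a(ba) for all a, b ∈ A), aa* commutes with every element of A for every a ∈ A, and (a,b,c) = (a,b*,c*) for all a, b, c ∈ A, where (a,b,c) := (ab)c − a(bc) denotes the associator. -/

import Mathlib

/-- `tau n a b = ab` if `n` is even and `ba` if `n` is odd. -/
def tau {A : Type*} [NonAssocRing A] (n : ℕ) (a b : A) : A :=
  if Even n then a * b else b * a

/-- The `m`-fold iterate `*^m` of the involution `*`. -/
def starIter {A : Type*} [NonAssocRing A] [StarRing A] : ℕ → A → A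
  | 0, a => a
  | m+1, a => star (starIter m a)

/-- The multiplication of the flipped non-associative skew polynomial ring `B = A[X;*]^fl`:
the biadditive extension of `(aX^m)(bX^n) = τ_n(a, *^m(b)) X^{m+n}`. Polynomials are
represented as finitely supported functions `ℕ →₀ A`. -/
noncomputable def fmul {A : Type*} [NonAssocRing A] [StarRing A] (p q : ℕ →₀ A) : ℕ →₀ A :=
  p.sum fun m a => q.sum fun n b => Finsupp.single (m+n) (tau n a (starIter m b))

/-- The map `α : B → B`, `α(Σ_i a_i X^i) = Σ_i (−1)^i *^{i+1}(a_i) X^i`. -/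
noncomputable def alphaMap {A : Type*} [NonAssocRing A] [StarRing A] (p : ℕ →₀ A) : ℕ →₀ A :=
  p.sum fun i a => Finsupp.single i ((-1 : ℤ) ^ i • starIter (i+1) a)

/-- The map `β : B → B`, `β(Σ_i a_i X^i) = Σ_i *^{i+1}(a_i) X^i`. -/
noncomputable def betaMap {A : Type*} [NonAssocRing A] [StarRing A] (p : ℕ →₀ A) : ℕ →₀ A :=
  p.sum fun i a => Finsupp.single i (starIter (i+1) a)

section Tau

variable {A : Type*} [NonAssocRing A]

theorem tau_zero_left (n : ℕ) (b : A) : tau n 0 b = 0 := by simp [tau]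

theorem tau_zero_right (n : ℕ) (a : A) : tau n a 0 = 0 := by simp [tau]

theorem tau_add_left (n : ℕ) (a b c : A) : tau n (a + b) c = tau n a c + tau n b c := by
  by_cases h : Even n <;> simp [tau, h, add_mul, mul_add]

theorem tau_add_right (n : ℕ) (a b c : A) : tau n a (b + c) = tau n a b + tau n a c := by
  by_cases h : Even n <;> simp [tau, h, add_mul, mul_add]

end Tau

section FlippedSkewPolynomial

variable {A : Type*} [NonAssocRing A] [StarRing A]

theorem starIter_eq_ite (m : ℕ) (a : A) : starIter m a = if Even m then a else star a := by
  induction m with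
  | zero => simp [starIter]
  | succ m ih =>
    by_cases h : Even m <;> simp [starIter, ih, h, Nat.even_add_one]

theorem starIter_zero_right (m : ℕ) : starIter m (0 : A) = 0 := by
  simp [starIter_eq_ite]

theorem starIter_add_right (m : ℕ) (a b : A) :
    starIter m (a + b) = starIter m a + starIter m b := by
  by_cases h : Even m <;> simp [starIter_eq_ite, h]

theorem zero_fmul (q : ℕ →₀ A) : fmul 0 q = 0 := by simp [fmul]

theorem fmul_zero (p : ℕ →₀ A) : fmul p 0 = 0 := by simp [fmul]

theorem add_fmul (p p' q : ℕ →₀ A) : fmul (p + p') q = fmul p q + fmul p' q := by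
  unfold fmul
  refine Finsupp.sum_add_index' ?_ ?_
  · simp [tau_zero_left]
  · simp [tau_add_left, Finsupp.sum_add]

theorem fmul_add (p q q' : ℕ →₀ A) : fmul p (q + q') = fmul p q + fmul p q' := by
  unfold fmul
  rw [← Finsupp.sum_add]
  refine Finsupp.sum_congr fun m _ => Finsupp.sum_add_index' ?_ ?_
  · simp [starIter_zero_right, tau_zero_right]
  · simp [starIter_add_right, tau_add_right]

theorem fmul_single (m n : ℕ) (a b : A) :
    fmul (Finsupp.single m a) (Finsupp.single n b) =
      Finsupp.single (m + n) (tau n a (starIter m b)) := by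
  simp [fmul, Finsupp.sum_single_index, tau_zero_left, tau_zero_right, starIter_zero_right]

/-- The associator of `B = A[X;*]^fl`. -/
noncomputable def fassoc (p q r : ℕ →₀ A) : ℕ →₀ A :=
  fmul (fmul p q) r - fmul p (fmul q r)

theorem fassoc_zero_left (q r : ℕ →₀ A) : fassoc 0 q r = 0 := by
  simp [fassoc, zero_fmul]

theorem fassoc_zero_middle (p r : ℕ →₀ A) : fassoc p 0 r = 0 := by
  simp [fassoc, zero_fmul, fmul_zero]

theorem fassoc_zero_right (p q : ℕ →₀ A) : fassoc p q 0 = 0 := by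
  simp [fassoc, fmul_zero]

theorem fassoc_add_left (p p' q r : ℕ →₀ A) :
    fassoc (p + p') q r = fassoc p q r + fassoc p' q r := by
  simp only [fassoc, add_fmul]; abel

theorem fassoc_add_middle (p q q' r : ℕ →₀ A) :
    fassoc p (q + q') r = fassoc p q r + fassoc p q' r := by
  simp only [fassoc, add_fmul, fmul_add]; abel

theorem fassoc_add_right (p q r r' : ℕ →₀ A) :
    fassoc p q (r + r') = fassoc p q r + fassoc p q r' := by
  simp only [fassoc, fmul_add]; abel

/-- The coefficient of the associator of the monomials `aX^i`, `bX^j`, `cX^k`. -/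
def monomialAssoc (i j k : ℕ) (a b c : A) : A :=
  tau k (tau j a (starIter i b)) (starIter (i + j) c) -
    tau (j + k) a (starIter i (tau k b (starIter j c)))

theorem fassoc_single (i j k : ℕ) (a b c : A) :
    fassoc (Finsupp.single i a) (Finsupp.single j b) (Finsupp.single k c) =
      Finsupp.single (i + j + k) (monomialAssoc i j k a b c) := by
  simp only [fassoc, fmul_single, monomialAssoc, Finsupp.single_sub, add_assoc]

theorem fassoc_add_swap_of_monomialAssoc
    (h : ∀ (i j k : ℕ) (a b c : A), monomialAssoc i j k a b c + monomialAssoc k j i c b a = 0)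
    (p q r : ℕ →₀ A) : fassoc p q r + fassoc r q p = 0 := by
  induction p using Finsupp.induction_linear with
  | zero => simp [fassoc_zero_left, fassoc_zero_right]
  | add p p' hp hp' =>
    rw [fassoc_add_left, fassoc_add_right, add_add_add_comm, hp, hp', add_zero]
  | single i a =>
  induction q using Finsupp.induction_linear with
  | zero => simp [fassoc_zero_middle]
  | add q q' hq hq' =>
    rw [fassoc_add_middle, fassoc_add_middle, add_add_add_comm, hq, hq', add_zero]
  | single j b =>
  induction r using Finsupp.induction_linear with
  | zero => simp [fassoc_zero_left, fassoc_zero_right]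
  | add r r' hr hr' =>
    rw [fassoc_add_left, fassoc_add_right, add_add_add_comm, hr, hr', add_zero]
  | single k c =>
    rw [fassoc_single, fassoc_single, show k + j + i = i + j + k by omega, ← Finsupp.single_add,
      h, Finsupp.single_zero]

/-- Flexibility of `B` can be checked on monomials, in its linearized form together with the
diagonal case. -/
theorem fassoc_self_eq_zero_iff :
    (∀ p q : ℕ →₀ A, fassoc p q p = 0) ↔
      (∀ (i j k : ℕ) (a b c : A), monomialAssoc i j k a b c + monomialAssoc k j i c b a = 0) ∧
      (∀ (i j : ℕ) (a b : A), monomialAssoc i j i a b a = 0) := by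
  constructor
  · intro h
    have single_eq_zero (n : ℕ) (a : A) (ha : Finsupp.single n a = 0) : a = 0 := by
      simpa using ha
    refine ⟨fun i j k a b c => ?_, fun i j a b => ?_⟩
    · have h1 := h (Finsupp.single i a + Finsupp.single k c) (Finsupp.single j b)
      rw [fassoc_add_left, fassoc_add_right, fassoc_add_right, h, h, zero_add, add_zero,
        fassoc_single, fassoc_single, show k + j + i = i + j + k by omega,
        ← Finsupp.single_add] at h1
      exact single_eq_zero _ _ h1
    · have h1 := h (Finsupp.single i a) (Finsupp.single j b)
      rw [fassoc_single] at h1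
      exact single_eq_zero _ _ h1
  · rintro ⟨hswap, hdiag⟩ p q
    induction p using Finsupp.induction_linear with
    | zero => exact fassoc_zero_left _ _
    | add p p' hp hp' =>
      rw [fassoc_add_left, fassoc_add_right, fassoc_add_right, hp, hp', zero_add, add_zero,
        fassoc_add_swap_of_monomialAssoc hswap]
    | single i a =>
    induction q using Finsupp.induction_linear with
    | zero => exact fassoc_zero_middle _ _
    | add q q' hq hq' => rw [fassoc_add_middle, hq, hq', add_zero]
    | single j b => rw [fassoc_single, hdiag, Finsupp.single_zero]

theorem conditions_of_monomialAssoc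
    (hswap : ∀ (i j k : ℕ) (a b c : A),
      monomialAssoc i j k a b c + monomialAssoc k j i c b a = 0)
    (hdiag : ∀ (i j : ℕ) (a b : A), monomialAssoc i j i a b a = 0) :
    (∀ a b : A, (a * b) * a = a * (b * a)) ∧
       (∀ a b : A, (a * star a) * b = b * (a * star a)) ∧
       (∀ a b c : A,
         (a * b) * c - a * (b * c) = (a * star b) * star c - a * (star b * star c)) := by
  have h00 (a b : A) : (a * b) * a - a * (b * a) = 0 := by
    simpa [monomialAssoc, tau, starIter] using hdiag 0 0 a b
  have h000 (a b c : A) : (a * b) * c - a * (b * c) + ((c * b) * a - c * (b * a)) = 0 := by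
    simpa [monomialAssoc, tau, starIter] using hswap 0 0 0 a b c
  have h001 (a b c : A) :
      c * (a * b) - (c * b) * a + ((c * star b) * star a - c * (star a * star b)) = 0 := by
    simpa [monomialAssoc, tau, starIter] using hswap 0 0 1 a b c
  have h101 (a b : A) : star a * (a * star b) - (star b * star a) * a = 0 := by
    simpa [monomialAssoc, tau, starIter] using hdiag 1 0 a b
  have h010 (a : A) : a * star a - star a * a = 0 := by
    simpa [monomialAssoc, tau, starIter] using hdiag 0 1 a 1
  have hassoc (a b c : A) :
      (a * b) * c - a * (b * c) = (a * star b) * star c - a * (star b * star c) := by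
    have h1 : a * (c * b - b * c + (star b * star c - star c * star b)) = 0 := by
      have := h001 c b 1
      simp only [one_mul] at this
      rw [this, mul_zero]
    simp only [mul_add, mul_sub] at h1
    linear_combination (norm := abel) h1 - h001 c b a
  refine ⟨fun a b => sub_eq_zero.mp (h00 a b), fun a b => ?_, hassoc⟩
  have hcomm : a * star a = star a * a := sub_eq_zero.mp (h010 a)
  have hmiddle := h101 a (star b)
  have hflex := h000 (star a) a b
  have hstar := hassoc b a (star a)
  simp only [star_star] at hmiddle hstar
  rw [hcomm] at hflex hstar ⊢
  linear_combination (norm := abel) hmiddle + hflex - hstar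

theorem monomialAssoc_of_conditions
    (hflex : ∀ a b : A, (a * b) * a = a * (b * a))
    (hcentral : ∀ a b : A, (a * star a) * b = b * (a * star a))
    (hassoc : ∀ a b c : A,
      (a * b) * c - a * (b * c) = (a * star b) * star c - a * (star b * star c)) :
    (∀ (i j k : ℕ) (a b c : A), monomialAssoc i j k a b c + monomialAssoc k j i c b a = 0) ∧
      (∀ (i j : ℕ) (a b : A), monomialAssoc i j i a b a = 0) := by
  have flex (a b c : A) : (a * b) * c - a * (b * c) + ((c * b) * a - c * (b * a)) = 0 := by
    have h := hflex (a + c) b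
    simp only [add_mul, mul_add] at h
    linear_combination (norm := abel) h - hflex a b - hflex c b
  have central (a b c : A) :
      (a * star b) * c + (b * star a) * c = c * (a * star b) + c * (b * star a) := by
    have h := hcentral (a + b) c
    simp only [star_add, add_mul, mul_add] at h
    linear_combination (norm := abel) h - hcentral a c - hcentral b c
  have trace (a b : A) : a * b + star a * b = b * a + b * star a := by
    simpa using central a 1 b
  have star_comm (a : A) : a * star a = star a * a := by
    linear_combination (norm := abel) -trace a a
  have star_commutator (a b : A) : a * b - b * a = star a * star b - star b * star a := by
    linear_combination (norm := abel) trace a b + trace b (star a)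
  have h010 (a b : A) : (b * a) * star a - (b * star a) * a = 0 := by
    have h := hassoc b a (star a)
    rw [star_star, star_comm] at h
    linear_combination (norm := abel) h
  have h101 (a b : A) : star a * (a * star b) - (star b * star a) * a = 0 := by
    have h1 := hassoc (star b) a (star a)
    have h2 := hcentral a (star b)
    have h3 := flex (star a) a (star b)
    rw [star_star, star_comm] at h1
    rw [star_comm] at h2 h3
    linear_combination (norm := abel) h1 + h2 - h3
  have h001 (a b c : A) :
      c * (a * b) - (c * b) * a + ((c * star b) * star a - c * (star a * star b)) = 0 := by
    have h := congrArg (c * ·) (star_commutator a b)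
    simp only [mul_sub] at h
    linear_combination (norm := abel) h - hassoc c b a
  have h011 (a b c : A) :
      star c * (b * a) - a * (star c * b) + ((star b * c) * a - (a * star b) * c) = 0 := by
    have h1 := central (star c) (star b) a
    have h2 := hassoc a b (star c)
    simp only [star_star] at h1 h2
    linear_combination (norm := abel) h1 + h2 - flex a b (star c)
  have h010' (a b c : A) : (b * a) * star c - (b * star c) * a +
      ((b * c) * star a - (b * star a) * c) = 0 := by
    have h := h010 (a + c) b
    simp only [star_add, add_mul, mul_add] at h
    linear_combination (norm := abel) h - h010 a b - h010 c b
  have h101' (a b c : A) : star c * (a * star b) - (star b * star c) * a +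
      (star a * (c * star b) - (star b * star a) * c) = 0 := by
    have h := h101 (a + c) b
    simp only [star_add, add_mul, mul_add] at h
    linear_combination (norm := abel) h - h101 a b - h101 c b
  refine ⟨fun i j k a b c => ?_, fun i j a b => ?_⟩
  · by_cases hi : Even i <;> by_cases hj : Even j <;> by_cases hk : Even k <;>
      simp only [monomialAssoc, tau, starIter_eq_ite, Nat.even_add, hi, hj, hk, if_true, if_false,
        iff_true, iff_false, not_true_eq_false, star_mul, star_star]
    · exact flex a b c
    · exact h001 a b c
    · exact h010' a b c
    · exact h011 a b c
    · rw [add_comm]; exact h001 c b a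
    · exact h101' a b c
    · rw [add_comm]; exact h011 c b a
    · abel
  · by_cases hi : Even i <;> by_cases hj : Even j <;>
      simp only [monomialAssoc, tau, starIter_eq_ite, Nat.even_add, hi, hj, if_true, if_false,
        iff_true, iff_false, not_true_eq_false, star_mul, star_star]
    · exact sub_eq_zero.mpr (hflex a b)
    · exact h010 a b
    · exact h101 a b
    · abel

end FlippedSkewPolynomial

/-- `B = A[X;*]^fl` is flexible if and only if `A` is flexible, `aa*` commutes
with every element of `A`, and `(a,b,c) = (a,b*,c*)` for all `a,b,c ∈ A`, where
`(a,b,c) = (ab)c − a(bc)` is the associator. -/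
theorem flipped_skew_polynomial_ring_flexible_iff
    {A : Type*} [NonAssocRing A] [StarRing A] :
    (∀ p q : ℕ →₀ A, fmul (fmul p q) p = fmul p (fmul q p)) ↔
      ((∀ a b : A, (a * b) * a = a * (b * a)) ∧
       (∀ a b : A, (a * star a) * b = b * (a * star a)) ∧
       (∀ a b c : A,
         (a * b) * c - a * (b * c) = (a * star b) * star c - a * (star b * star c))) := by
  have h := fassoc_self_eq_zero_iff (A := A)
  simp only [fassoc, sub_eq_zero] at h
  rw [h]
  exact ⟨fun ⟨hswap, hdiag⟩ => conditions_of_monomialAssoc hswap hdiag,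
    fun ⟨hflex, hcentral, hassoc⟩ => monomialAssoc_of_conditions hflex hcentral hassoc⟩
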